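/- (Puig) Let λ > 0, α ∈ ℝ irrational, E ∈ ℝ, and δ > 0. Suppose g : ℂ → ℂ is holomorphic on the strip {z : |Im z| < δ}, 1-periodic (g(z+1) = g(z)), real-valued on ℝ, and the sequence u(n) = g(nα) satisfies u(n+1) + u(n−1) + 2λ^{−1} cos(2πnα) u(n) = (λ^{−1}E) u(n) for every n ∈ ℤ. Then the Fourier coefficients ĝ(n) = ∫₀¹ g(θ) e^{−2πinθ} dθ decay exponentially (there exist constants C > 0 and β > 0 with |ĝ(n)| ≤ C e^{−β|n|}), and the sequence v(n) = ĝ(n) satisfies v(n+1) + v(n−1) + 2λ cos(2πnα) v(n) = E v(n) for every n ∈ ℤ. -/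

import Mathlib

/-- The `n`-th Fourier coefficient `ĝ(n) = ∫₀¹ g(θ) e^{−2πinθ} dθ` of a 1-periodic
function `g` (viewed through its values on the reals). -/
noncomputable def fourierCoeff' (g : ℂ → ℂ) (n : ℤ) : ℂ :=
  ∫ θ in (0:ℝ)..1, g θ * Complex.exp (-(2 * Real.pi * Complex.I * n * θ))

theorem Continuous.eq_zero_of_forall_int_mul_irrational {F : ℝ → ℂ} (hF : Continuous F)
    (hper : Function.Periodic F 1) {α : ℝ} (hα : Irrational α)
    (hzero : ∀ n : ℤ, F (n * α) = 0) (x : ℝ) : F x = 0 := by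
  have hd : Dense (AddSubgroup.closure {1, α} : Set ℝ) := by
    rw [dense_addSubgroupClosure_pair_iff]
    simpa using hα
  have hc : IsClosed {x : ℝ | F x = 0} := isClosed_eq hF continuous_const
  have hs : (AddSubgroup.closure {1, α} : Set ℝ) ⊆ {x : ℝ | F x = 0} := by
    intro y hy
    obtain ⟨m, n, rfl⟩ := AddSubgroup.mem_closure_pair.1 hy
    have h := hper.int_mul m (n * α)
    simp only [Set.mem_ofPred_eq, zsmul_eq_mul, mul_one]
    rw [add_comm, ← hzero n, ← h, mul_one]
  have := hc.closure_subset_iff.2 hs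
  rw [hd.closure_eq] at this
  exact this (Set.mem_univ x)

theorem cexp_neg_two_pi_I_int_periodic (n : ℤ) (z : ℂ) :
    Complex.exp (-(2 * Real.pi * Complex.I * n * (z + 1))) =
      Complex.exp (-(2 * Real.pi * Complex.I * n * z)) := by
  rw [Complex.exp_eq_exp_iff_exists_int]
  exact ⟨-n, by push_cast; ring⟩

theorem integral_comp_add_mul_cexp {g : ℂ → ℂ} (hper : ∀ z : ℂ, g (z + 1) = g z)
    (n : ℤ) (a : ℝ) :
    ∫ θ in (0:ℝ)..1, g (θ + a) * Complex.exp (-(2 * Real.pi * Complex.I * n * θ)) =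
      Complex.exp (2 * Real.pi * Complex.I * n * a) * fourierCoeff' g n := by
  have hp : Function.Periodic
      (fun θ : ℝ => g θ * Complex.exp (-(2 * Real.pi * Complex.I * n * θ))) 1 := by
    intro θ
    simp only [Complex.ofReal_add, Complex.ofReal_one]
    rw [hper, cexp_neg_two_pi_I_int_periodic]
  have h := hp.intervalIntegral_add_eq a 0
  have h2 := intervalIntegral.integral_comp_add_right
    (fun θ : ℝ => g θ * Complex.exp (-(2 * Real.pi * Complex.I * n * θ))) (a := 0) (b := 1) a
  rw [zero_add, add_comm 1 a, h, zero_add] at h2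
  rw [fourierCoeff', ← h2, ← intervalIntegral.integral_const_mul]
  refine intervalIntegral.integral_congr fun θ _ => ?_
  simp only [Complex.ofReal_add]
  rw [mul_left_comm, ← Complex.exp_add]
  congr 2
  ring

theorem fourierCoeff'_eq_integral_add_mul_I {g : ℂ → ℂ} {δ : ℝ}
    (hghol : DifferentiableOn ℂ g {z : ℂ | |z.im| < δ})
    (hgper : ∀ z : ℂ, g (z + 1) = g z) {y : ℝ} (hy : |y| < δ) (n : ℤ) :
    fourierCoeff' g n = ∫ x in (0:ℝ)..1, g (x + y * Complex.I) *
      Complex.exp (-(2 * Real.pi * Complex.I * n * (x + y * Complex.I))) := by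
  set f : ℂ → ℂ := fun z => g z * Complex.exp (-(2 * Real.pi * Complex.I * n * z)) with hf
  have hfper : ∀ z, f (z + 1) = f z := fun z => by
    simp only [hf]
    rw [hgper, cexp_neg_two_pi_I_int_periodic]
  have hd : DifferentiableOn ℂ f {z : ℂ | |z.im| < δ} :=
    hghol.mul (Differentiable.differentiableOn (by fun_prop))
  have h := Complex.integral_boundary_rect_eq_zero_of_differentiableOn f 0 (1 + y * Complex.I)
    (hd.mono fun z hz => by
      have hz2 := hz.2
      simp only [Set.mem_preimage, Complex.zero_im, Complex.add_im, Complex.one_im,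
        Complex.mul_im, Complex.ofReal_re, Complex.ofReal_im, Complex.I_re, Complex.I_im,
        mul_one, mul_zero, add_zero, zero_add] at hz2
      have := Set.abs_sub_left_of_mem_uIcc hz2
      simp only [sub_zero] at this
      exact this.trans_lt hy)
  have hv : ∀ t : ℝ, f (1 + t * Complex.I) = f (t * Complex.I) := fun t => by
    rw [add_comm, hfper]
  simp [hv] at h
  exact sub_eq_zero.1 h

theorem norm_fourierCoeff'_le {g : ℂ → ℂ} {δ M : ℝ}
    (hghol : DifferentiableOn ℂ g {z : ℂ | |z.im| < δ})
    (hgper : ∀ z : ℂ, g (z + 1) = g z) {y : ℝ} (hy : |y| < δ)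
    (hM : ∀ x ∈ Set.Icc (0:ℝ) 1, ‖g (x + y * Complex.I)‖ ≤ M) (n : ℤ) :
    ‖fourierCoeff' g n‖ ≤ M * Real.exp (2 * Real.pi * n * y) := by
  rw [fourierCoeff'_eq_integral_add_mul_I hghol hgper hy]
  refine (intervalIntegral.norm_integral_le_of_norm_le_const
    (C := M * Real.exp (2 * Real.pi * n * y)) fun x hx => ?_).trans_eq (by simp)
  rw [Set.uIoc_of_le zero_le_one] at hx
  rw [norm_mul, Complex.norm_exp]
  have : (-(2 * Real.pi * Complex.I * n * (x + y * Complex.I))).re = 2 * Real.pi * n * y := by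
    simp
  rw [this]
  gcongr
  exact hM x ⟨hx.1.le, hx.2⟩

theorem exists_norm_fourierCoeff'_le_exp {g : ℂ → ℂ} {δ : ℝ} (hδ : 0 < δ)
    (hghol : DifferentiableOn ℂ g {z : ℂ | |z.im| < δ})
    (hgper : ∀ z : ℂ, g (z + 1) = g z) :
    ∃ C > (0 : ℝ), ∃ β > (0 : ℝ),
      ∀ n : ℤ, ‖fourierCoeff' g n‖ ≤ C * Real.exp (-β * |(n : ℝ)|) := by
  have hbound : ∀ y : ℝ, |y| < δ →
      ∃ M : ℝ, ∀ x ∈ Set.Icc (0:ℝ) 1, ‖g (x + y * Complex.I)‖ ≤ M := fun y hy =>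
    isCompact_Icc.exists_bound_of_continuousOn
      (hghol.continuousOn.comp (by fun_prop) fun x _ => by simpa using hy)
  have hpos : |δ / 2| < δ := by rw [abs_of_pos (half_pos hδ)]; exact half_lt_self hδ
  have hneg : |-(δ / 2)| < δ := by rwa [abs_neg]
  obtain ⟨M₁, hM₁⟩ := hbound _ hpos
  obtain ⟨M₂, hM₂⟩ := hbound _ hneg
  refine ⟨|M₁| + |M₂| + 1, by positivity, Real.pi * δ, by positivity, fun n => ?_⟩
  rcases le_total 0 (n : ℝ) with hn | hn
  · refine (norm_fourierCoeff'_le hghol hgper hneg hM₂ n).trans ?_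
    rw [abs_of_nonneg hn]
    refine mul_le_mul ?_ (Real.exp_le_exp.2 (le_of_eq (by ring))) (by positivity) (by positivity)
    linarith [le_abs_self M₂, abs_nonneg M₁]
  · refine (norm_fourierCoeff'_le hghol hgper hpos hM₁ n).trans ?_
    rw [abs_of_nonpos hn]
    refine mul_le_mul ?_ (Real.exp_le_exp.2 (le_of_eq (by ring))) (by positivity) (by positivity)
    linarith [le_abs_self M₁, abs_nonneg M₂]

theorem ofReal_two_mul_cos (x : ℝ) :
    ((2 * Real.cos x : ℝ) : ℂ) = Complex.exp (x * Complex.I) + Complex.exp (-(x * Complex.I)) := by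
  rw [Complex.ofReal_mul, Complex.ofReal_cos, Complex.cos, neg_mul]
  push_cast
  ring

/-- Puig: if `g` is holomorphic on the strip `{|Im z| < δ}`, 1-periodic, real-valued on `ℝ`,
and `u(n) = g(nα)` solves the dual almost Mathieu equation at coupling `λ⁻¹`, energy
`λ⁻¹E` and phase `0`, then the Fourier coefficients `ĝ(n)` decay exponentially and form a
solution of the almost Mathieu equation at coupling `λ` and energy `E`. -/
theorem puig_dual_to_decaying (lam α E δ : ℝ) (hlam : 0 < lam) (hα : Irrational α)
    (hδ : 0 < δ) (g : ℂ → ℂ)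
    (hghol : DifferentiableOn ℂ g {z : ℂ | |z.im| < δ})
    (hgper : ∀ z : ℂ, g (z + 1) = g z)
    (hgreal : ∀ x : ℝ, (g x).im = 0)
    (hsol : ∀ n : ℤ,
      g (↑(((n : ℝ) + 1) * α)) + g (↑(((n : ℝ) - 1) * α)) +
        (↑(2 * lam⁻¹ * Real.cos (2 * Real.pi * n * α)) : ℂ) * g (↑((n : ℝ) * α)) =
      (↑(lam⁻¹ * E) : ℂ) * g (↑((n : ℝ) * α))) :
    (∃ C > (0 : ℝ), ∃ β > (0 : ℝ),
      ∀ n : ℤ, ‖fourierCoeff' g n‖ ≤ C * Real.exp (-β * |(n : ℝ)|)) ∧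
    ∀ n : ℤ,
      fourierCoeff' g (n + 1) + fourierCoeff' g (n - 1) +
        (↑(2 * lam * Real.cos (2 * Real.pi * n * α)) : ℂ) * fourierCoeff' g n =
      (E : ℂ) * fourierCoeff' g n := by
  refine ⟨exists_norm_fourierCoeff'_le_exp hδ hghol hgper, fun n => ?_⟩
  have hgc : Continuous fun x : ℝ => g x :=
    hghol.continuousOn.comp_continuous (by fun_prop) fun x => by simpa using hδ
  have hgca : ∀ a : ℝ, Continuous fun x : ℝ => g (x + a) := fun a => by
    have : Continuous fun x : ℝ => x + a := by fun_prop
    simpa [Function.comp_def] using hgc.comp this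
  have hlam' : (lam : ℂ) ≠ 0 := by exact_mod_cast hlam.ne'
  have key : ∀ θ : ℝ, lam * g (θ + α) + lam * g (θ + (-α : ℝ)) +
      (2 * Real.cos (2 * Real.pi * θ) : ℝ) * g θ - E * g θ = 0 := by
    refine Continuous.eq_zero_of_forall_int_mul_irrational ?_ ?_ hα ?_
    · have h₁ := hgca α
      have h₂ := hgca (-α)
      have h₃ : Continuous fun θ : ℝ => ((2 * Real.cos (2 * Real.pi * θ) : ℝ) : ℂ) := by fun_prop
      exact (((h₁.const_mul _).add (h₂.const_mul _)).add (h₃.mul hgc)).sub (hgc.const_mul _)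
    · intro θ
      have hcos : Real.cos (2 * Real.pi * (θ + 1)) = Real.cos (2 * Real.pi * θ) := by
        rw [mul_add, mul_one, Real.cos_add_two_pi]
      simp only [hcos, Complex.ofReal_add θ 1, Complex.ofReal_one, add_right_comm _ (1 : ℂ), hgper]
    · intro k
      have h := hsol k
      have e₁ : ((((k : ℝ) + 1) * α : ℝ) : ℂ) = ((k * α : ℝ) : ℂ) + α := by push_cast; ring
      have e₂ : ((((k : ℝ) - 1) * α : ℝ) : ℂ) = ((k * α : ℝ) : ℂ) + (-α : ℝ) := by
        push_cast; ring
      rw [e₁, e₂, mul_assoc (2 * Real.pi) (k : ℝ) α] at h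
      rw [mul_right_comm 2 lam⁻¹, Complex.ofReal_mul _ lam⁻¹, Complex.ofReal_mul lam⁻¹,
        Complex.ofReal_inv] at h
      linear_combination (lam : ℂ) * h -
        ((2 * Real.cos (2 * Real.pi * (k * α)) : ℝ) * g ((k * α : ℝ) : ℂ) -
          E * g ((k * α : ℝ) : ℂ)) * mul_inv_cancel₀ hlam'
  have hint : ∫ θ in (0:ℝ)..1,
      (lam * (g (θ + α) * Complex.exp (-(2 * Real.pi * Complex.I * n * θ))) +
      lam * (g (θ + (-α : ℝ)) * Complex.exp (-(2 * Real.pi * Complex.I * n * θ))) +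
      g θ * Complex.exp (-(2 * Real.pi * Complex.I * (n - 1 : ℤ) * θ)) +
      g θ * Complex.exp (-(2 * Real.pi * Complex.I * (n + 1 : ℤ) * θ)) -
      E * (g θ * Complex.exp (-(2 * Real.pi * Complex.I * n * θ)))) = 0 := by
    refine intervalIntegral.integral_zero_ae (Filter.Eventually.of_forall fun θ _ => ?_)
    have e₁ : Complex.exp (-(2 * Real.pi * Complex.I * (n - 1 : ℤ) * θ)) =
        Complex.exp ((2 * Real.pi * θ : ℝ) * Complex.I) *
          Complex.exp (-(2 * Real.pi * Complex.I * n * θ)) := by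
      rw [← Complex.exp_add]
      congr 1
      push_cast
      ring
    have e₂ : Complex.exp (-(2 * Real.pi * Complex.I * (n + 1 : ℤ) * θ)) =
        Complex.exp (-((2 * Real.pi * θ : ℝ) * Complex.I)) *
          Complex.exp (-(2 * Real.pi * Complex.I * n * θ)) := by
      rw [← Complex.exp_add]
      congr 1
      push_cast
      ring
    have hk := key θ
    rw [ofReal_two_mul_cos] at hk
    rw [e₁, e₂]
    linear_combination Complex.exp (-(2 * Real.pi * Complex.I * n * θ)) * hk
  have hi : ∀ (a : ℝ) (m : ℤ), IntervalIntegrable (fun θ : ℝ => g (θ + a) *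
      Complex.exp (-(2 * Real.pi * Complex.I * m * θ))) MeasureTheory.volume 0 1 := fun a m =>
    ((hgca a).mul (by fun_prop)).intervalIntegrable _ _
  have hi0 : ∀ m : ℤ, IntervalIntegrable (fun θ : ℝ => g θ *
      Complex.exp (-(2 * Real.pi * Complex.I * m * θ))) MeasureTheory.volume 0 1 := fun m =>
    (hgc.mul (by fun_prop)).intervalIntegrable _ _
  have h₁ := (hi α n).const_mul (lam : ℂ)
  have h₂ := (hi (-α) n).const_mul (lam : ℂ)
  have h₃ := hi0 (n - 1)
  have h₄ := hi0 (n + 1)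
  rw [intervalIntegral.integral_sub (((h₁.add h₂).add h₃).add h₄) ((hi0 n).const_mul (E : ℂ)),
    intervalIntegral.integral_add ((h₁.add h₂).add h₃) h₄,
    intervalIntegral.integral_add (h₁.add h₂) h₃, intervalIntegral.integral_add h₁ h₂] at hint
  simp only [intervalIntegral.integral_const_mul] at hint
  rw [integral_comp_add_mul_cexp hgper, integral_comp_add_mul_cexp hgper] at hint
  have hcoeff : ∀ m : ℤ, ∫ θ in (0:ℝ)..1, g θ *
      Complex.exp (-(2 * Real.pi * Complex.I * m * θ)) = fourierCoeff' g m := fun _ => rfl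
  simp only [hcoeff] at hint
  have e₁ : Complex.exp (2 * Real.pi * Complex.I * n * α) =
      Complex.exp ((2 * Real.pi * n * α : ℝ) * Complex.I) := by
    congr 1
    push_cast
    ring
  have e₂ : Complex.exp (2 * Real.pi * Complex.I * n * (-α : ℝ)) =
      Complex.exp (-((2 * Real.pi * n * α : ℝ) * Complex.I)) := by
    congr 1
    push_cast
    ring
  rw [e₁, e₂] at hint
  rw [mul_right_comm 2 lam, Complex.ofReal_mul, ofReal_two_mul_cos]
  linear_combination hint
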